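/- arXiv:1807.04125 — 2 statements merged into one kernel-verified Lean document; each statement's English description precedes it below -/
import Mathlib

section
/- Let λ be a nonzero real number, let β, α be real numbers with β ≥ 1 and α > 1, let m be a natural number and ε a real number with -2β < ε < 2β, ε ≠ 0, ε ≠ 1, such that α = 2βm + ε, and assume additionally that ε ≠ 2βn + 1 for every integer n with -m ≤ n ≤ -1. Define, for y > 0, F(y) = (1/λ) · y^{1-2β-α}/(1-2β-α) + (-1)^{m+1} (λ^{2m+1}/Γ(2m+3)) · y^{1-ε}/(1-ε) + ∑_{n=-m}^{-1} (-1)^{n+m+1} (λ^{2n+2m+1}/Γ(2n+2m+3)) · y^{2βn-ε+1}/(2βn-ε+1) + ∑_{n=0}^{∞} (-1)^{n+m} (λ^{2n+2m+3}/Γ(2n+2m+5)) · y^{2βn+2β-ε+1}/(2βn+2β-ε+1). Then for every x > 0, F is differentiable at x and F′(x) = cos(λ x^β)/(λ x^{2β+α}). -/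
open Real

/-- Antiderivative of a monomial with real exponent, away from the logarithmic case. -/
theorem hasDerivAt_mul_rpow_div (c : ℝ) {e s x : ℝ} (hx : 0 < x) (hs : s ≠ 0) (he : s = e + 1) :
    HasDerivAt (fun y : ℝ => c * (y ^ s / s)) (c * x ^ e) x := by
  have h := (((Real.hasDerivAt_rpow_const (p := s) (Or.inl hx.ne')).div_const s).const_mul c)
  have hse : s - 1 = e := by rw [he]; ring
  rwa [mul_div_cancel_left₀ _ hs, hse] at h

/-- The terms of the cosine series of `lam * x ^ β`, divided by `lam * x ^ γ`. -/
theorem cos_series_term_div (lam β γ : ℝ) {x : ℝ} (hx : 0 < x) (k : ℕ) :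
    (-1 : ℝ) ^ k * (lam * x ^ β) ^ (2 * k) / ((2 * k).factorial : ℝ) / (lam * x ^ γ) =
      (-1 : ℝ) ^ k * (lam ^ (2 * k) / lam / ((2 * k).factorial : ℝ)) *
        x ^ (2 * β * k - γ) := by
  have h : (x ^ β) ^ (2 * k) = x ^ (2 * β * k) := by
    rw [← Real.rpow_mul_natCast hx.le]; push_cast; ring_nf
  rw [mul_pow, h, Real.rpow_sub hx]
  ring

/-- The terms of the cosine series of `lam * x ^ β` of positive order, divided by
`lam * x ^ γ`, with the leading power of `lam` simplified. -/
theorem cos_series_succ_term_div {lam : ℝ} (hlam : lam ≠ 0) (β γ : ℝ) {x : ℝ} (hx : 0 < x)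
    (k : ℕ) :
    (-1 : ℝ) ^ (k + 1) * (lam * x ^ β) ^ (2 * (k + 1)) / ((2 * (k + 1)).factorial : ℝ) /
        (lam * x ^ γ) =
      (-1 : ℝ) ^ (k + 1) * (lam ^ (2 * k + 1) / Real.Gamma (2 * (k : ℝ) + 3)) *
        x ^ (2 * β * (k + 1) - γ) := by
  have hG : Real.Gamma (2 * (k : ℝ) + 3) = ((2 * (k + 1)).factorial : ℝ) := by
    rw [← Real.Gamma_nat_eq_factorial]; push_cast; ring_nf
  have hp : lam ^ (2 * (k + 1)) / lam = lam ^ (2 * k + 1) := by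
    rw [show 2 * (k + 1) = 2 * k + 1 + 1 by ring, pow_succ, mul_div_cancel_right₀ _ hlam]
  rw [cos_series_term_div lam β γ hx, hp, hG]
  push_cast
  rfl

/-- Reindexing a sum over the negative integers `-m, …, -1` by `0, …, m - 1`. -/
theorem sum_Icc_neg_eq_sum_range {M : Type*} [AddCommMonoid M] (m : ℕ) (f : ℤ → M) :
    ∑ n ∈ Finset.Icc (-(m : ℤ)) (-1), f n = ∑ i ∈ Finset.range m, f ((i : ℤ) - m) := by
  symm
  refine Finset.sum_bij (fun i _ => (i : ℤ) - m) ?_ ?_ ?_ ?_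
  · intro i hi
    simp only [Finset.mem_range] at hi
    simp only [Finset.mem_Icc]
    omega
  · intro i _ j _ hij
    simpa using hij
  · intro n hn
    simp only [Finset.mem_Icc] at hn
    exact ⟨(n + m).toNat, by simp only [Finset.mem_range]; omega, by omega⟩
  · intro i _
    rfl

/-- A series of real powers `∑ c n * y ^ (e n + 1) / (e n + 1)` with nonnegative exponents `e n`
may be differentiated termwise on `(0, R)` when `∑ c n * R ^ e n` converges absolutely. -/
theorem hasDerivAt_tsum_mul_rpow_div {c e s : ℕ → ℝ} {x R : ℝ} (hx : 0 < x) (hxR : x < R)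
    (he : ∀ n, 0 ≤ e n) (hs : ∀ n, s n = e n + 1) (hsum : Summable fun n => |c n| * R ^ e n) :
    HasDerivAt (fun y : ℝ => ∑' n, c n * (y ^ s n / s n)) (∑' n, c n * x ^ e n) x := by
  have hs1 (n : ℕ) : 1 ≤ s n := by rw [hs]; linarith [he n]
  have hbound (n : ℕ) (y : ℝ) (hy : y ∈ Set.Ioo 0 R) :
      ‖c n * y ^ e n‖ ≤ |c n| * R ^ e n := by
    rw [norm_mul, Real.norm_eq_abs, Real.norm_of_nonneg (Real.rpow_nonneg hy.1.le _)]
    exact mul_le_mul_of_nonneg_left (Real.rpow_le_rpow hy.1.le hy.2.le (he n)) (abs_nonneg _)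
  refine hasDerivAt_tsum_of_isPreconnected hsum isOpen_Ioo isPreconnected_Ioo
    (fun n y hy => hasDerivAt_mul_rpow_div (c n) hy.1 (by linarith [hs1 n]) (hs n))
    hbound (y₀ := x) ⟨hx, hxR⟩ ?_ ⟨hx, hxR⟩
  refine Summable.of_norm_bounded (hsum.mul_right x) fun n => ?_
  have hfac : c n * (x ^ s n / s n) = c n * x ^ e n * (x / s n) := by
    rw [hs, Real.rpow_add hx, Real.rpow_one]; ring
  rw [hfac, norm_mul, Real.norm_of_nonneg (by have := hs1 n; positivity : 0 ≤ x / s n)]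
  exact mul_le_mul (hbound n x ⟨hx, hxR⟩) (div_le_self hx.le (hs1 n))
    (by have := hs1 n; positivity) (by have := hx.trans hxR; positivity)

open Real

/-- Theorem 3, case ε ∈ (-2β,0)∪(0,1)∪(1,2β) (cosine integral with `α = 2βm + ε`). -/
theorem cos_integral_eps_general (lam β α ε : ℝ) (hlam : lam ≠ 0) (hβ : 1 ≤ β) (hα : 1 < α)
    (m : ℕ) (hε₁ : -(2 * β) < ε) (hε₂ : ε < 2 * β) (hε₀ : ε ≠ 0) (hε₃ : ε ≠ 1)
    (hαm : α = 2 * β * m + ε)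
    (hden : ∀ n : ℤ, -(m : ℤ) ≤ n → n ≤ -1 → ε ≠ 2 * β * (n : ℝ) + 1) :
    ∀ x : ℝ, 0 < x →
      HasDerivAt (fun y : ℝ =>
        (1 / lam) * (y ^ (1 - 2 * β - α) / (1 - 2 * β - α)) +
        (-1 : ℝ) ^ (m + 1) * (lam ^ (2 * m + 1) / Real.Gamma (2 * (m : ℝ) + 3)) *
          (y ^ (1 - ε) / (1 - ε)) +
        (∑ n ∈ Finset.Icc (-(m : ℤ)) (-1 : ℤ),
          (-1 : ℝ) ^ (n + (m : ℤ) + 1) *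
            (lam ^ (2 * n + 2 * (m : ℤ) + 1) / Real.Gamma (2 * (n : ℝ) + 2 * (m : ℝ) + 3)) *
            (y ^ (2 * β * (n : ℝ) - ε + 1) / (2 * β * (n : ℝ) - ε + 1))) +
        ∑' n : ℕ,
          (-1 : ℝ) ^ (n + m) *
            (lam ^ (2 * n + 2 * m + 3) / Real.Gamma (2 * (n : ℝ) + 2 * (m : ℝ) + 5)) *
            (y ^ (2 * β * (n : ℝ) + 2 * β - ε + 1) / (2 * β * (n : ℝ) + 2 * β - ε + 1)))
        (Real.cos (lam * x ^ β) / (lam * x ^ (2 * β + α))) x := by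
  intro x hx
  have hb : 0 < 2 * β - ε := by linarith
  have hterm (y : ℝ) (hy : 0 < y) (n : ℕ) :
      (-1 : ℝ) ^ (n + (m + 2)) * (lam * y ^ β) ^ (2 * (n + (m + 2))) /
          ((2 * (n + (m + 2))).factorial : ℝ) / (lam * y ^ (2 * β + α)) =
        (-1 : ℝ) ^ (n + m) *
          (lam ^ (2 * n + 2 * m + 3) / Real.Gamma (2 * (n : ℝ) + 2 * (m : ℝ) + 5)) *
          y ^ (2 * β * (n : ℝ) + 2 * β - ε) := by
    have h := cos_series_succ_term_div hlam β (2 * β + α) hy (n + m + 1)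
    have hexp : 2 * β * (((n + m + 1 : ℕ) : ℝ) + 1) - (2 * β + α) =
        2 * β * (n : ℝ) + 2 * β - ε := by rw [hαm]; push_cast; ring
    have hG : 2 * ((n + m + 1 : ℕ) : ℝ) + 3 = 2 * (n : ℝ) + 2 * (m : ℝ) + 5 := by
      push_cast; ring
    have hsgn : (-1 : ℝ) ^ (n + m + 1 + 1) = (-1) ^ (n + m) := by ring
    have hidx : n + (m + 2) = n + m + 1 + 1 := by ring
    rw [hidx, h, hexp, hG, show 2 * (n + m + 1) + 1 = 2 * n + 2 * m + 3 by ring, hsgn]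
  have hcos : HasSum (fun k : ℕ => (-1 : ℝ) ^ k * (lam * x ^ β) ^ (2 * k) /
      ((2 * k).factorial : ℝ) / (lam * x ^ (2 * β + α)))
      (Real.cos (lam * x ^ β) / (lam * x ^ (2 * β + α))) :=
    (Real.hasSum_cos _).div_const _
  have hsum : Summable fun n : ℕ => |(-1 : ℝ) ^ (n + m) *
      (lam ^ (2 * n + 2 * m + 3) / Real.Gamma (2 * (n : ℝ) + 2 * (m : ℝ) + 5))| *
      (x + 1) ^ (2 * β * (n : ℝ) + 2 * β - ε) := by
    have hR : 0 < x + 1 := by linarith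
    have h := (((Real.hasSum_cos (lam * (x + 1) ^ β)).summable.div_const
      (lam * (x + 1) ^ (2 * β + α))).comp_injective (add_left_injective (m + 2))).abs
    refine h.congr fun n => ?_
    simp only [Function.comp_apply]
    rw [hterm _ hR, abs_mul _ ((x + 1) ^ _), abs_of_pos (Real.rpow_pos_of_pos hR _)]
  have htail := hasDerivAt_tsum_mul_rpow_div (s := fun n : ℕ => 2 * β * (n : ℝ) + 2 * β - ε + 1)
    hx (lt_add_one x) (fun n => by have := n.cast_nonneg (α := ℝ); nlinarith) (fun n => rfl) hsum
  have hmid : HasDerivAt (fun y : ℝ => ∑ n ∈ Finset.Icc (-(m : ℤ)) (-1 : ℤ),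
      (-1 : ℝ) ^ (n + (m : ℤ) + 1) *
        (lam ^ (2 * n + 2 * (m : ℤ) + 1) / Real.Gamma (2 * (n : ℝ) + 2 * (m : ℝ) + 3)) *
        (y ^ (2 * β * (n : ℝ) - ε + 1) / (2 * β * (n : ℝ) - ε + 1)))
      (∑ n ∈ Finset.Icc (-(m : ℤ)) (-1 : ℤ), (-1 : ℝ) ^ (n + (m : ℤ) + 1) *
        (lam ^ (2 * n + 2 * (m : ℤ) + 1) / Real.Gamma (2 * (n : ℝ) + 2 * (m : ℝ) + 3)) *
        x ^ (2 * β * (n : ℝ) - ε)) x := by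
    refine HasDerivAt.fun_sum fun n hn => hasDerivAt_mul_rpow_div _ hx (fun h => ?_) rfl
    rw [Finset.mem_Icc] at hn
    exact hden n hn.1 hn.2 (by linarith)
  have hfirst := hasDerivAt_mul_rpow_div (1 / lam) (e := -(2 * β + α)) (s := 1 - 2 * β - α) hx
    (by linarith) (by ring)
  have hsecond := hasDerivAt_mul_rpow_div
    ((-1 : ℝ) ^ (m + 1) * (lam ^ (2 * m + 1) / Real.Gamma (2 * (m : ℝ) + 3))) (e := -ε)
    (s := 1 - ε) hx (sub_ne_zero.mpr hε₃.symm) (by ring)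
  refine (((hfirst.add hsecond).add hmid).add htail).congr_deriv (Eq.symm ?_)
  rw [← hcos.tsum_eq, ← hcos.summable.sum_add_tsum_nat_add (m + 2)]
  congr 1
  · rw [Finset.sum_range_succ', Finset.sum_range_succ, sum_Icc_neg_eq_sum_range, add_comm,
      add_comm (Finset.sum _ _), ← add_assoc]
    congr 1
    · congr 1
      · rw [cos_series_term_div lam β _ hx]
        simp
      · rw [cos_series_succ_term_div hlam β _ hx, hαm]
        congr 2
        ring
    · refine Finset.sum_congr rfl fun i _ => ?_
      rw [cos_series_succ_term_div hlam β _ hx]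
      have hsgn : (i : ℤ) - m + m + 1 = ((i + 1 : ℕ) : ℤ) := by push_cast; ring
      have hpow : 2 * ((i : ℤ) - m) + 2 * m + 1 = ((2 * i + 1 : ℕ) : ℤ) := by push_cast; ring
      rw [hsgn, hpow, zpow_natCast, zpow_natCast, hαm]
      push_cast
      ring_nf
  · exact tsum_congr (hterm x hx)
end

section
/- Let λ be a nonzero real number, let m be a positive integer and ε a real number with -1 < ε < 1 and ε ≠ 0, and set α = m + ε; assume α > 1. Define, for y > 0, F(y) = -1/(λ α y^{α}) + (λ^{m}/Γ(m+2)) · y^{1-ε}/(1-ε) + ∑_{n=-m}^{-1} (λ^{n+m}/Γ(n+m+2)) · y^{n-ε+1}/(n-ε+1) + ∑_{n=0}^{∞} (λ^{n+m+1}/Γ(n+m+3)) · y^{n+2-ε}/(n+2-ε). Then for every x > 0, F is differentiable at x and F′(x) = exp(λ x)/(λ x^{1+α}). -/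
open Real

theorem pow_div_Gamma_mul_rpow {lam : ℝ} (hlam : lam ≠ 0) {x : ℝ} (hx : 0 < x) (α : ℝ) (k : ℕ) :
    lam ^ k / Real.Gamma ((k : ℝ) + 2) * x ^ ((k : ℝ) - α) =
      (lam * x) ^ (k + 1) / ((k + 1).factorial : ℝ) * (1 / (lam * x ^ (1 + α))) := by
  have hG : Real.Gamma ((k : ℝ) + 2) = ((k + 1).factorial : ℝ) := by
    rw [← Real.Gamma_nat_eq_factorial]
    congr 1
    push_cast
    ring
  have hp : x ^ ((k : ℝ) - α) = x ^ (k + 1) / x ^ (1 + α) := by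
    rw [← Real.rpow_natCast, ← Real.rpow_sub hx]
    congr 1
    push_cast
    ring
  have hx' : x ^ (1 + α) ≠ 0 := (Real.rpow_pos_of_pos hx _).ne'
  have hf : ((k + 1).factorial : ℝ) ≠ 0 := by positivity
  rw [hG, hp, mul_pow, pow_succ lam]
  field_simp

theorem hasDerivAt_const_mul_rpow_div (c : ℝ) {p x : ℝ} (hp : p ≠ 0) (hx : 0 < x) :
    HasDerivAt (fun y : ℝ => c * (y ^ p / p)) (c * x ^ (p - 1)) x := by
  refine (((Real.hasDerivAt_rpow_const (p := p) (Or.inl hx.ne')).div_const p).const_mul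
    c).congr_deriv ?_
  rw [mul_div_cancel_left₀ _ hp]

theorem sum_Icc_neg_natCast {M : Type*} [AddCommMonoid M] (m : ℕ) (f : ℤ → M) :
    ∑ n ∈ Finset.Icc (-(m : ℤ)) (-1 : ℤ), f n = ∑ j ∈ Finset.range m, f ((j : ℤ) - m) := by
  symm
  refine Finset.sum_nbij' (fun j : ℕ => (j : ℤ) - m) (fun n : ℤ => (n + m).toNat) ?_ ?_ ?_ ?_ ?_
  · intro j hj
    simp only [Finset.mem_range, Finset.mem_Icc] at *
    omega
  · intro j hj
    simp only [Finset.mem_range, Finset.mem_Icc] at *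
    omega
  · intro j hj
    simp
  · intro n hn
    simp only [Finset.mem_Icc] at *
    omega
  · intro j hj
    rfl

theorem summable_pow_div_Gamma_mul_rpow {lam : ℝ} (hlam : lam ≠ 0) {x : ℝ} (hx : 0 < x)
    (m : ℕ) (ε : ℝ) :
    Summable fun n : ℕ => lam ^ (n + m + 1) / Real.Gamma ((n : ℝ) + (m : ℝ) + 3) *
      x ^ ((n : ℝ) + 1 - ε) := by
  have h := ((summable_nat_add_iff (m + 2)).2
    (Real.summable_pow_div_factorial (lam * x))).mul_right (1 / (lam * x ^ (1 + ((m : ℝ) + ε))))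
  refine h.congr fun n => ?_
  have := pow_div_Gamma_mul_rpow hlam hx ((m : ℝ) + ε) (n + m + 1)
  rw [show n + (m + 2) = n + m + 1 + 1 by ring, ← this]
  push_cast
  ring_nf

theorem hasDerivAt_tsum_pow_div_Gamma_mul_rpow {lam : ℝ} (hlam : lam ≠ 0) {x : ℝ} (hx : 0 < x)
    (m : ℕ) {ε : ℝ} (hε : ε < 1) :
    HasDerivAt (fun y : ℝ => ∑' n : ℕ,
        (lam ^ (n + m + 1) / Real.Gamma ((n : ℝ) + (m : ℝ) + 3)) *
          (y ^ ((n : ℝ) + 2 - ε) / ((n : ℝ) + 2 - ε)))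
      (∑' n : ℕ, lam ^ (n + m + 1) / Real.Gamma ((n : ℝ) + (m : ℝ) + 3) *
        x ^ ((n : ℝ) + 1 - ε)) x := by
  have hp (n : ℕ) : 1 < (n : ℝ) + 2 - ε := by
    have : (0 : ℝ) ≤ n := n.cast_nonneg
    linarith
  have hG (n : ℕ) : 0 < Real.Gamma ((n : ℝ) + (m : ℝ) + 3) := Real.Gamma_pos_of_pos (by positivity)
  have hmem : x ∈ Set.Ioo 0 (2 * x) := ⟨hx, by linarith⟩
  refine hasDerivAt_tsum_of_isPreconnected
    (g' := fun n y => lam ^ (n + m + 1) / Real.Gamma ((n : ℝ) + (m : ℝ) + 3) *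
      y ^ ((n : ℝ) + 1 - ε))
    (summable_pow_div_Gamma_mul_rpow (abs_ne_zero.2 hlam) (x := 2 * x) (by positivity) m ε)
    isOpen_Ioo isPreconnected_Ioo ?_ ?_ hmem ?_ hmem
  · intro n y hy
    refine (hasDerivAt_const_mul_rpow_div _ (by linarith [hp n] : (n : ℝ) + 2 - ε ≠ 0)
      hy.1).congr_deriv ?_
    ring_nf
  · intro n y hy
    have hy0 := hy.1
    rw [norm_mul, norm_div, norm_pow, Real.norm_eq_abs, Real.norm_of_nonneg (hG n).le,
      Real.norm_of_nonneg (Real.rpow_nonneg hy0.le _)]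
    have := hG n
    have := Real.rpow_le_rpow hy0.le hy.2.le (by linarith [hp n] : 0 ≤ (n : ℝ) + 1 - ε)
    gcongr
  · refine Summable.of_norm_bounded
      ((summable_pow_div_Gamma_mul_rpow hlam hx m ε).norm.mul_right x) fun n => ?_
    have h1 : x ^ ((n : ℝ) + 2 - ε) = x ^ ((n : ℝ) + 1 - ε) * x := by
      rw [← Real.rpow_add_one hx.ne']
      congr 1
      ring
    have h2 : x ^ ((n : ℝ) + 2 - ε) / ((n : ℝ) + 2 - ε) ≤ x ^ ((n : ℝ) + 1 - ε) * x :=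
      h1 ▸ div_le_self (Real.rpow_nonneg hx.le _) (hp n).le
    have h3 : 0 ≤ x ^ ((n : ℝ) + 2 - ε) / ((n : ℝ) + 2 - ε) :=
      div_nonneg (Real.rpow_nonneg hx.le _) (by linarith [hp n])
    rw [norm_mul, norm_mul, mul_assoc, Real.norm_of_nonneg h3,
      Real.norm_of_nonneg (Real.rpow_nonneg hx.le _)]
    gcongr

/-- Corollary 1, part 2 (exponential integral `Ei_{1,1+α}`, `α = m + ε`, `ε ∈ (-1,0)∪(0,1)`). -/
theorem exp_integral_corollary_frac (lam α ε : ℝ) (hlam : lam ≠ 0)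
    (m : ℕ) (hm : 0 < m) (hε₁ : -1 < ε) (hε₂ : ε < 1) (hε₀ : ε ≠ 0)
    (hαm : α = m + ε) (hα : 1 < α) :
    ∀ x : ℝ, 0 < x →
      HasDerivAt (fun y : ℝ =>
        -(1 / (lam * α * y ^ α)) +
        (lam ^ m / Real.Gamma ((m : ℝ) + 2)) * (y ^ (1 - ε) / (1 - ε)) +
        (∑ n ∈ Finset.Icc (-(m : ℤ)) (-1 : ℤ),
          (lam ^ (n + (m : ℤ)) / Real.Gamma ((n : ℝ) + (m : ℝ) + 2)) *
            (y ^ ((n : ℝ) - ε + 1) / ((n : ℝ) - ε + 1))) +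
        ∑' n : ℕ,
          (lam ^ (n + m + 1) / Real.Gamma ((n : ℝ) + (m : ℝ) + 3)) *
            (y ^ ((n : ℝ) + 2 - ε) / ((n : ℝ) + 2 - ε)))
        (Real.exp (lam * x) / (lam * x ^ (1 + α))) x := by
  intro x hx
  set D : ℝ := 1 / (lam * x ^ (1 + α)) with hD
  set e : ℕ → ℝ := fun k => (lam * x) ^ k / (k.factorial : ℝ) with he
  have hpole : HasDerivAt (fun y : ℝ => -(1 / (lam * α * y ^ α))) (e 0 * D) x := by
    have h := (((Real.hasDerivAt_rpow_const (p := α) (Or.inl hx.ne')).const_mul (lam * α)).inv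
      (mul_ne_zero (mul_ne_zero hlam (by linarith)) (Real.rpow_pos_of_pos hx α).ne')).neg
    simp only [one_div]
    refine h.congr_deriv ?_
    have hxα := (Real.rpow_pos_of_pos hx α).ne'
    have hα0 : α ≠ 0 := by linarith
    simp only [he, hD, Real.rpow_add hx, Real.rpow_sub hx, Real.rpow_one, pow_zero,
      Nat.factorial_zero, Nat.cast_one]
    field_simp
  have hmid : HasDerivAt (fun y : ℝ =>
      (lam ^ m / Real.Gamma ((m : ℝ) + 2)) * (y ^ (1 - ε) / (1 - ε))) (e (m + 1) * D) x := by
    refine (hasDerivAt_const_mul_rpow_div _ (by linarith : 1 - ε ≠ 0) hx).congr_deriv ?_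
    rw [he, hD, ← pow_div_Gamma_mul_rpow hlam hx α m, hαm]
    ring_nf
  have hsum : HasDerivAt (fun y : ℝ => ∑ n ∈ Finset.Icc (-(m : ℤ)) (-1 : ℤ),
      (lam ^ (n + (m : ℤ)) / Real.Gamma ((n : ℝ) + (m : ℝ) + 2)) *
        (y ^ ((n : ℝ) - ε + 1) / ((n : ℝ) - ε + 1)))
      (∑ j ∈ Finset.range m, e (j + 1) * D) x := by
    simp only [sum_Icc_neg_natCast]
    refine HasDerivAt.fun_sum fun j hj => ?_
    have hp : (((j : ℤ) - m : ℤ) : ℝ) - ε + 1 ≠ 0 := by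
      intro h
      have h1 : ε = (((j : ℤ) - m + 1 : ℤ) : ℝ) := by
        push_cast at h ⊢
        linarith
      rw [h1] at hε₁ hε₂ hε₀
      norm_cast at hε₁ hε₂ hε₀
      omega
    refine (hasDerivAt_const_mul_rpow_div _ hp hx).congr_deriv ?_
    rw [he, hD, ← pow_div_Gamma_mul_rpow hlam hx α j, hαm, sub_add_cancel, zpow_natCast]
    push_cast
    ring_nf
  have htail := hasDerivAt_tsum_pow_div_Gamma_mul_rpow hlam hx m hε₂
  have hterm (n : ℕ) : lam ^ (n + m + 1) / Real.Gamma ((n : ℝ) + (m : ℝ) + 3) *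
      x ^ ((n : ℝ) + 1 - ε) = e (n + (m + 2)) * D := by
    rw [he, hD, show n + (m + 2) = n + m + 1 + 1 by ring,
      ← pow_div_Gamma_mul_rpow hlam hx α (n + m + 1), hαm]
    push_cast
    ring_nf
  simp only [hterm, tsum_mul_right] at htail
  refine (((hpole.add hmid).add hsum).add htail).congr_deriv ?_
  have hexp : Real.exp (lam * x) = ∑' k, e k := by
    rw [Real.exp_eq_exp_ℝ, NormedSpace.exp_eq_tsum_div]
  rw [hexp, ← (Real.summable_pow_div_factorial (lam * x)).sum_add_tsum_nat_add (m + 2),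
    Finset.sum_range_succ, Finset.sum_range_succ', ← Finset.sum_mul, hD]
  ring
end
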